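/- With F ⊆ [0,1] as constructed (the Cantor set F = ⋂_k (∑_{i=1}^k δ_i[N_i] + [0,δ_k]) with c_k = (N_0+k)^{-1}, N_k = ⌈(N_0+k)^{t/2}⌉), for every positive rational ξ ∈ ℚ the set F + ξF satisfies dim_H(F + ξF) = dim_B(F + ξF) = t/2. -/

import Mathlib

open Filter Set

/-- The least number of sets of diameter at most `δ` needed to cover `F`. -/
noncomputable def coverN {X : Type*} [PseudoMetricSpace X] (F : Set X) (δ : ℝ) : ℕ :=
  sInf {n : ℕ | ∃ U : Fin n → Set X,
    (∀ i, EMetric.diam (U i) ≤ ENNReal.ofReal δ) ∧ F ⊆ ⋃ i, U i}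

/-- Upper box (Minkowski) dimension. -/
noncomputable def upperBoxDim {X : Type*} [PseudoMetricSpace X] (F : Set X) : ℝ :=
  Filter.limsup (fun δ : ℝ => Real.log (coverN F δ) / -Real.log δ)
    (nhdsWithin 0 (Set.Ioi 0))

/-- Lower box (Minkowski) dimension. -/
noncomputable def lowerBoxDim {X : Type*} [PseudoMetricSpace X] (F : Set X) : ℝ :=
  Filter.liminf (fun δ : ℝ => Real.log (coverN F δ) / -Real.log δ)
    (nhdsWithin 0 (Set.Ioi 0))

/-- `N_k = ⌈(N₀+k)^{t/2}⌉`. -/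
noncomputable def CN (N₀ : ℕ) (t : ℝ) (k : ℕ) : ℕ := ⌈((N₀ : ℝ) + k) ^ (t / 2)⌉₊

/-- `δ_k = ∏_{i=1}^k (N₀+i)⁻¹`. -/
noncomputable def Cδ (N₀ : ℕ) (k : ℕ) : ℝ := ∏ i ∈ Finset.Icc 1 k, ((N₀ : ℝ) + i)⁻¹

/-- The level-`k` set `F_k = ∑_{i=1}^k δ_i [N_i] + [0, δ_k]`. -/
noncomputable def CFlevel (N₀ : ℕ) (t : ℝ) (k : ℕ) : Set ℝ :=
  {x | ∃ f : ℕ → ℕ, (∀ i ∈ Finset.Icc 1 k, f i < CN N₀ t i) ∧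
    ∃ r ∈ Set.Icc (0:ℝ) (Cδ N₀ k), x = (∑ i ∈ Finset.Icc 1 k, Cδ N₀ i * f i) + r}

/-- The Cantor set `F = ⋂ₖ F_k`. -/
noncomputable def CF (N₀ : ℕ) (t : ℝ) : Set ℝ := ⋂ k, CFlevel N₀ t k



lemma Cd_succ (N₀ k : ℕ) : Cδ N₀ (k+1) = Cδ N₀ k * ((N₀:ℝ) + (k+1))⁻¹ := by
  unfold Cδ
  rw [Finset.prod_Icc_succ_top (by omega)]
  push_cast; rfl

lemma Cd_pos (N₀ k : ℕ) : 0 < Cδ N₀ k := by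
  unfold Cδ
  apply Finset.prod_pos
  intro i hi
  have := (Finset.mem_Icc.1 hi).1
  positivity

lemma Cd_zero (N₀ : ℕ) : Cδ N₀ 0 = 1 := by simp [Cδ]

lemma Cd_succ' (N₀ k : ℕ) : Cδ N₀ (k+1) * ((N₀:ℝ) + (k+1)) = Cδ N₀ k := by
  rw [Cd_succ, mul_assoc, inv_mul_cancel₀ (by positivity), mul_one]

/-- `L_k = log (1/δ_k)` -/
noncomputable def CL (N₀ k : ℕ) : ℝ := - Real.log (Cδ N₀ k)

lemma CL_succ (N₀ k : ℕ) : CL N₀ (k+1) = CL N₀ k + Real.log ((N₀:ℝ) + (k+1)) := by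
  unfold CL
  rw [Cd_succ, Real.log_mul (Cd_pos _ _).ne' (by positivity), Real.log_inv]
  ring

lemma CL_zero (N₀ : ℕ) : CL N₀ 0 = 0 := by simp [CL, Cd_zero]

lemma CL_nonneg (N₀ k : ℕ) : 0 ≤ CL N₀ k := by
  induction k with
  | zero => rw [CL_zero]
  | succ k ih =>
    rw [CL_succ]
    have : 0 ≤ Real.log ((N₀:ℝ) + (k+1)) := Real.log_nonneg (by
      have : (0:ℝ) ≤ N₀ := by positivity
      have : (0:ℝ) ≤ k := by positivity
      linarith)
    linarith

lemma Cd_eq_exp (N₀ k : ℕ) : Cδ N₀ k = Real.exp (- CL N₀ k) := by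
  unfold CL
  rw [neg_neg, Real.exp_log (Cd_pos _ _)]

lemma CL_lin (N₀ : ℕ) (A : ℝ) (hA : 0 ≤ A) : ∃ C : ℝ, 0 ≤ C ∧ ∀ k : ℕ, A * k ≤ CL N₀ k + C := by
  obtain ⟨m, hm⟩ := exists_nat_ge (Real.exp A)
  refine ⟨A * m, by positivity, ?_⟩
  intro k
  induction k with
  | zero => rw [CL_zero]; simp; positivity
  | succ k ih =>
    by_cases h : k + 1 ≤ m
    · have h1 : ((k+1 : ℕ):ℝ) ≤ m := by exact_mod_cast h
      have := mul_le_mul_of_nonneg_left h1 hA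
      have := CL_nonneg N₀ (k+1)
      linarith
    · have h1 : (m:ℝ) ≤ k + 1 := by exact_mod_cast (by omega : m ≤ k+1)
      rw [CL_succ]
      have : A ≤ Real.log ((N₀:ℝ) + (k+1)) := by
        rw [Real.le_log_iff_exp_le (by positivity)]
        have : (0:ℝ) ≤ N₀ := by positivity
        linarith
      push_cast
      linarith

lemma CL_succ_le (N₀ k : ℕ) : CL N₀ (k+1) ≤ CL N₀ k + (N₀ + k) := by
  rw [CL_succ]
  have := Real.log_le_sub_one_of_pos (x := (N₀:ℝ) + (k+1)) (by positivity)
  linarith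

/-- `P_k = N_1 ⋯ N_k` -/
noncomputable def CP (N₀ : ℕ) (t : ℝ) (k : ℕ) : ℕ := ∏ i ∈ Finset.Icc 1 k, CN N₀ t i

lemma CP_succ (N₀ : ℕ) (t : ℝ) (k : ℕ) : CP N₀ t (k+1) = CP N₀ t k * CN N₀ t (k+1) := by
  unfold CP
  rw [Finset.prod_Icc_succ_top (by omega)]

lemma CP_zero (N₀ : ℕ) (t : ℝ) : CP N₀ t 0 = 1 := by simp [CP]

lemma CN_ge (N₀ : ℕ) (t : ℝ) (k : ℕ) :
    Real.exp (t/2 * Real.log ((N₀:ℝ) + (k+1))) ≤ CN N₀ t (k+1) := by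
  unfold CN
  refine le_trans (le_of_eq ?_) (Nat.le_ceil _)
  rw [Real.rpow_def_of_pos (by positivity)]
  push_cast
  ring_nf

lemma CN_le (N₀ : ℕ) (t : ℝ) (ht : 0 < t) (k : ℕ) :
    (CN N₀ t (k+1) : ℝ) ≤ 2 * Real.exp (t/2 * Real.log ((N₀:ℝ) + (k+1))) := by
  have h1 : (1:ℝ) ≤ ((N₀ : ℝ) + (k+1:ℕ)) ^ (t / 2) := by
    apply Real.one_le_rpow _ (by positivity)
    have : (0:ℝ) ≤ N₀ := by positivity
    have : (0:ℝ) ≤ k := by positivity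
    push_cast
    linarith
  have h2 : Real.exp (t/2 * Real.log ((N₀:ℝ) + (k+1))) = ((N₀ : ℝ) + (k+1:ℕ)) ^ (t / 2) := by
    rw [Real.rpow_def_of_pos (by positivity)]
    push_cast
    ring_nf
  rw [h2]
  unfold CN
  have := Nat.ceil_lt_add_one (a := ((N₀ : ℝ) + (k+1:ℕ)) ^ (t / 2)) (by positivity)
  linarith

lemma CP_ge (N₀ : ℕ) (t : ℝ) (k : ℕ) : Real.exp (t/2 * CL N₀ k) ≤ CP N₀ t k := by
  induction k with
  | zero => simp [CL_zero, CP_zero]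
  | succ k ih =>
    rw [CL_succ, CP_succ, mul_add, Real.exp_add]
    push_cast
    have := CN_ge N₀ t k
    gcongr

lemma CP_le (N₀ : ℕ) (t : ℝ) (ht : 0 < t) (k : ℕ) :
    (CP N₀ t k : ℝ) ≤ 2^k * Real.exp (t/2 * CL N₀ k) := by
  induction k with
  | zero => simp [CL_zero, CP_zero]
  | succ k ih =>
    rw [CL_succ, CP_succ, mul_add, Real.exp_add, pow_succ]
    push_cast
    have := CN_le N₀ t ht k
    calc _ ≤ (2^k * Real.exp (t/2 * CL N₀ k)) * (2 * Real.exp (t/2 * Real.log ((N₀:ℝ) + (k+1)))) := by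
          gcongr
      _ = _ := by ring

/-! ### Covers -/

lemma coverN_le {X : Type*} [PseudoMetricSpace X] {F : Set X} {δ : ℝ} {n : ℕ} (U : Fin n → Set X)
    (h1 : ∀ i, EMetric.diam (U i) ≤ ENNReal.ofReal δ) (h2 : F ⊆ ⋃ i, U i) : coverN F δ ≤ n :=
  Nat.sInf_le ⟨U, h1, h2⟩

lemma coverN_spec {X : Type*} [PseudoMetricSpace X] {F : Set X} {δ : ℝ} {n : ℕ} (U : Fin n → Set X)
    (h1 : ∀ i, EMetric.diam (U i) ≤ ENNReal.ofReal δ) (h2 : F ⊆ ⋃ i, U i) :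
    ∃ U : Fin (coverN F δ) → Set X,
      (∀ i, EMetric.diam (U i) ≤ ENNReal.ofReal δ) ∧ F ⊆ ⋃ i, U i :=
  Nat.sInf_mem (s := {n : ℕ | ∃ U : Fin n → Set X,
    (∀ i, EMetric.diam (U i) ≤ ENNReal.ofReal δ) ∧ F ⊆ ⋃ i, U i}) ⟨n, U, h1, h2⟩

lemma dimH_le_of_frequently {E : Set ℝ} {s : ℝ} (hs : 0 < s)
    (h : ∃ᶠ δ in nhdsWithin (0:ℝ) (Set.Ioi 0), ∃ n : ℕ, (n:ℝ) ≤ δ ^ (-s) ∧ ∃ U : Fin n → Set ℝ,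
      (∀ i, EMetric.diam (U i) ≤ ENNReal.ofReal δ) ∧ E ⊆ ⋃ i, U i) :
    dimH E ≤ ENNReal.ofReal s := by
  have h' := h.and_eventually (self_mem_nhdsWithin)
  obtain ⟨d, hd, hP⟩ := exists_seq_forall_of_frequently h'
  choose hP hpos using hP
  choose n hn U hU hE using hP
  have hd0 : Tendsto d atTop (nhds 0) := hd.mono_right nhdsWithin_le_nhds
  have key := MeasureTheory.Measure.hausdorffMeasure_le_liminf_sum s E
    (l := atTop) (fun k => ENNReal.ofReal (d k))
    (by simpa using ENNReal.tendsto_ofReal hd0) (fun k i => U k i)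
    (Eventually.of_forall hU) (Eventually.of_forall hE)
  have hle : (MeasureTheory.Measure.hausdorffMeasure s) E ≤ 1 := by
    refine key.trans ?_
    refine (liminf_le_liminf (v := fun _ => (1:ENNReal)) (Eventually.of_forall ?_)).trans
      (by simp)
    intro k
    have hk : 0 < d k := hpos k
    calc ∑ i, EMetric.diam (U k i) ^ s ≤ ∑ i : Fin (n k), ENNReal.ofReal (d k) ^ s := by
          gcongr with i
          exact hU k i
      _ = ENNReal.ofReal ((n k) * (d k)^s) := by
          rw [Finset.sum_const, Finset.card_univ, Fintype.card_fin, nsmul_eq_mul,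
            ENNReal.ofReal_mul (by positivity), ENNReal.ofReal_natCast,
            ENNReal.ofReal_rpow_of_pos hk]
      _ ≤ ENNReal.ofReal 1 := by
          apply ENNReal.ofReal_le_ofReal
          calc (n k) * (d k)^s ≤ (d k)^(-s) * (d k)^s := by
                gcongr; exact hn k
            _ = 1 := by rw [← Real.rpow_add hk]; simp
      _ = 1 := by simp
  have := dimH_le_of_hausdorffMeasure_ne_top (s := E) (d := s.toNNReal)
    (by rw [Real.coe_toNNReal _ hs.le]; exact (hle.trans_lt ENNReal.one_lt_top).ne)
  exact this

lemma box_of_bounds {E : Set ℝ} {u : ℝ} (hu : 0 < u)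
    (hcov : ∀ δ : ℝ, 0 < δ → ∃ n : ℕ, ∃ U : Fin n → Set ℝ,
      (∀ i, EMetric.diam (U i) ≤ ENNReal.ofReal δ) ∧ E ⊆ ⋃ i, U i)
    (hup : ∀ ε > 0, ∀ᶠ δ in nhdsWithin (0:ℝ) (Set.Ioi 0),
      Real.log (coverN E δ) / -Real.log δ ≤ u + ε)
    (hlow : ENNReal.ofReal u ≤ dimH E) :
    dimH E = ENNReal.ofReal u ∧ lowerBoxDim E = u ∧ upperBoxDim E = u := by
  have hlt1 : ∀ᶠ δ in nhdsWithin (0:ℝ) (Set.Ioi 0), δ < 1 :=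
    nhdsWithin_le_nhds (Iio_mem_nhds one_pos)
  have hfr : ∀ s > 0, (∃ᶠ δ in nhdsWithin (0:ℝ) (Set.Ioi 0),
      Real.log (coverN E δ) / -Real.log δ ≤ s) → dimH E ≤ ENNReal.ofReal s := by
    intro s hs h
    apply dimH_le_of_frequently hs
    refine (h.and_eventually (hlt1.and self_mem_nhdsWithin)).mono ?_
    rintro δ ⟨h, h1, h0⟩
    have h0 : 0 < δ := h0
    refine ⟨coverN E δ, ?_, ?_⟩
    · have hl := Real.log_neg h0 h1
      rw [div_le_iff₀ (by linarith)] at h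
      rcases Nat.eq_zero_or_pos (coverN E δ) with hz | hz
      · rw [hz]; simp; positivity
      · rw [Real.rpow_def_of_pos h0, ← Real.log_le_iff_le_exp (by exact_mod_cast hz)]
        linarith
    · obtain ⟨n, U, a, b⟩ := hcov δ h0
      exact coverN_spec U a b
  have hT : Tendsto (fun δ : ℝ => Real.log (coverN E δ) / -Real.log δ)
      (nhdsWithin 0 (Set.Ioi 0)) (nhds u) := by
    rw [tendsto_order]
    constructor
    · intro a ha
      by_contra hcon
      rw [not_eventually] at hcon
      have h3 := hfr (max a (u/2)) (lt_max_of_lt_right (by linarith))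
        (hcon.mono fun δ hδ => le_max_of_le_left (not_lt.1 hδ))
      have h4 := hlow.trans h3
      rw [ENNReal.ofReal_le_ofReal_iff (le_max_of_le_right (by linarith))] at h4
      have : max a (u/2) < u := max_lt ha (by linarith)
      linarith
    · intro b hb
      filter_upwards [hup ((b-u)/2) (by linarith)] with δ h
      linarith
  refine ⟨le_antisymm ?_ hlow, hT.liminf_eq, hT.limsup_eq⟩
  have : Tendsto (fun ε : ℝ => ENNReal.ofReal (u + ε)) (nhdsWithin 0 (Set.Ioi 0))
      (nhds (ENNReal.ofReal u)) := by
    apply ENNReal.tendsto_ofReal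
    apply Tendsto.mono_left _ nhdsWithin_le_nhds
    have : Continuous fun ε : ℝ => u + ε := by fun_prop
    simpa using this.tendsto 0
  refine ge_of_tendsto this ?_
  filter_upwards [self_mem_nhdsWithin] with ε hε
  have hε : 0 < ε := hε
  exact hfr _ (by linarith) (hup ε hε).frequently

/-! ### The upper bound -/

/-- The sumset. -/
def CE (N₀ : ℕ) (t : ℝ) (ξ : ℝ) : Set ℝ :=
  {z : ℝ | ∃ x ∈ CF N₀ t, ∃ y ∈ CF N₀ t, z = x + ξ * y}

lemma CE_cover (N₀ : ℕ) (t : ℝ) (ξ : ℝ) (p q : ℕ) (hq : 0 < q) (hξ : ξ * q = p) (hξ0 : 0 < ξ)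
    (k : ℕ) :
    ∃ U : Fin ((p+q)^k * CP N₀ t k) → Set ℝ,
      (∀ i, EMetric.diam (U i) ≤ ENNReal.ofReal ((1+ξ) * Cδ N₀ k)) ∧ CE N₀ t ξ ⊆ ⋃ i, U i := by
  classical
  let S := Fintype.piFinset (fun i : Finset.Icc 1 k => Finset.range ((p+q) * CN N₀ t i))
  have hcard : S.card = (p+q)^k * CP N₀ t k := by
    simp only [S, Fintype.card_piFinset, Finset.card_range]
    rw [Finset.prod_coe_sort (Finset.Icc 1 k) (fun i => (p+q) * CN N₀ t i),
      Finset.prod_mul_distrib]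
    simp [CP]
  rw [← hcard]
  let V : (Finset.Icc 1 k → ℕ) → Set ℝ := fun m =>
    Icc ((∑ i : Finset.Icc 1 k, Cδ N₀ i * m i) / q)
      ((∑ i : Finset.Icc 1 k, Cδ N₀ i * m i) / q + (1+ξ) * Cδ N₀ k)
  refine ⟨fun i => V (S.equivFin.symm i), ?_, ?_⟩
  · intro i
    simp only [V]
    refine (Real.ediam_Icc _ _).le.trans ?_
    rw [add_sub_cancel_left]
  · rintro z ⟨x, hx, y, hy, rfl⟩
    obtain ⟨f, hf, r, hr, rfl⟩ := Set.mem_iInter.1 hx k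
    obtain ⟨g, hg, r', hr', rfl⟩ := Set.mem_iInter.1 hy k
    let m : Finset.Icc 1 k → ℕ := fun i => q * f i + p * g i
    have hm : m ∈ S := by
      simp only [S, Fintype.mem_piFinset, Finset.mem_range, m]
      intro i
      have h1 := hf i i.2
      have h2 := hg i i.2
      have h3 : q * f i < q * CN N₀ t i := Nat.mul_lt_mul_of_pos_left h1 hq
      have h4 : p * g i ≤ p * CN N₀ t i := Nat.mul_le_mul_left _ h2.le
      rw [add_mul]
      omega
    rw [Set.mem_iUnion]
    refine ⟨S.equivFin ⟨m, hm⟩, ?_⟩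
    simp only [Equiv.symm_apply_apply, V]
    have hq' : (q:ℝ) ≠ 0 := by exact_mod_cast hq.ne'
    have hsum : (∑ i : Finset.Icc 1 k, Cδ N₀ i * (m i : ℝ)) / q
        = (∑ i ∈ Finset.Icc 1 k, Cδ N₀ i * f i) + ξ * (∑ i ∈ Finset.Icc 1 k, Cδ N₀ i * g i) := by
      rw [div_eq_iff hq']
      simp only [m]
      rw [Finset.sum_coe_sort (Finset.Icc 1 k)
        (fun i => Cδ N₀ i * ((q * f i + p * g i : ℕ):ℝ)), Finset.mul_sum, ← Finset.sum_add_distrib,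
        Finset.sum_mul]
      refine Finset.sum_congr rfl fun i _ => ?_
      push_cast
      rw [← hξ]
      ring
    rw [hsum]
    have h5 := mul_nonneg hξ0.le hr'.1
    have h6 := mul_le_mul_of_nonneg_left hr'.2 hξ0.le
    have h7 := hr.1
    have h8 := hr.2
    constructor <;> linarith

lemma exists_level (N₀ : ℕ) (c δ : ℝ) (hc : 0 < c) (hδ : 0 < δ) : ∃ k, c * Cδ N₀ k ≤ δ := by
  obtain ⟨C, _, hC⟩ := CL_lin N₀ 1 zero_le_one
  obtain ⟨k, hk⟩ := exists_nat_ge (C - Real.log (δ / c))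
  refine ⟨k, ?_⟩
  have h1 := hC k
  rw [← le_div_iff₀' hc, Cd_eq_exp, ← Real.le_log_iff_exp_le (by positivity)]
  linarith

lemma CE_up (N₀ : ℕ) (t : ℝ) (ht : 0 < t) (ξ : ℝ) (p q : ℕ) (hq : 0 < q) (hξ : ξ * q = p)
    (hξ0 : 0 < ξ) (ε : ℝ) (hε : 0 < ε) : ∀ᶠ δ in nhdsWithin (0:ℝ) (Set.Ioi 0),
      Real.log (coverN (CE N₀ t ξ) δ) / -Real.log δ ≤ t/2 + ε := by
  set M : ℝ := Real.log (2 * (p+q)) with hM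
  have hq1 : (1:ℝ) ≤ q := by exact_mod_cast hq
  have hp0 : (0:ℝ) ≤ p := by positivity
  have hM0 : 0 ≤ M := Real.log_nonneg (by linarith)
  obtain ⟨C, hC0, hC⟩ := CL_lin N₀ ((M + t/2) / (ε/2)) (by positivity)
  set c := Real.log (1+ξ) with hc
  set D : ℝ := (ε/2) * C + M + t/2 * N₀ + (t/2+ε/2) * c with hD
  have hsm : ∀ᶠ δ in nhdsWithin (0:ℝ) (Set.Ioi 0), D / (ε/2) ≤ - Real.log δ := by
    have := Real.tendsto_log_nhdsGT_zero
    filter_upwards [this.eventually_le_atBot (-(D/(ε/2)))] with δ h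
    linarith
  have hlt1 : ∀ᶠ δ in nhdsWithin (0:ℝ) (Set.Ioi 0), δ < 1 :=
    nhdsWithin_le_nhds (Iio_mem_nhds one_pos)
  filter_upwards [hsm, hlt1, self_mem_nhdsWithin] with δ h1 h2 h3
  have h3 : 0 < δ := h3
  have hl := Real.log_neg h3 h2
  rw [div_le_iff₀ (by linarith)]
  have hex := exists_level N₀ (1+ξ) δ (by linarith) h3
  classical
  obtain ⟨j, hj1, hj2⟩ : ∃ j, (1+ξ) * Cδ N₀ (j+1) ≤ δ ∧ δ < (1+ξ) * Cδ N₀ j := by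
    have hne : Nat.find hex ≠ 0 := by
      intro h0
      have := Nat.find_spec hex
      rw [h0, Cd_zero] at this
      linarith
    obtain ⟨j, hj⟩ := Nat.exists_eq_succ_of_ne_zero hne
    refine ⟨j, ?_, ?_⟩
    · have := Nat.find_spec hex
      rwa [hj] at this
    · exact not_le.1 (Nat.find_min hex (by omega))
  have hL : CL N₀ j ≤ -Real.log δ + c := by
    have := Real.log_lt_log h3 hj2
    rw [Real.log_mul (by linarith) (Cd_pos _ _).ne'] at this
    unfold CL
    linarith
  obtain ⟨U, hU1, hU2⟩ := CE_cover N₀ t ξ p q hq hξ hξ0 (j+1)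
  have hcov := coverN_le (δ := δ) U
    (fun i => (hU1 i).trans (ENNReal.ofReal_le_ofReal hj1)) hU2
  have hlog : Real.log (coverN (CE N₀ t ξ) δ) ≤ (j+1) * M + t/2 * CL N₀ (j+1) := by
    have hnn : 0 ≤ (j+1) * M + t/2 * CL N₀ (j+1) := by
      have := CL_nonneg N₀ (j+1)
      positivity
    rcases Nat.eq_zero_or_pos (coverN (CE N₀ t ξ) δ) with hz | hz
    · rw [hz]; simpa using hnn
    · rw [Real.log_le_iff_le_exp (by exact_mod_cast hz)]
      have h4 : (coverN (CE N₀ t ξ) δ : ℝ) ≤ (p+q)^(j+1) * CP N₀ t (j+1) := by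
        exact_mod_cast hcov
      refine h4.trans ?_
      have h5 := CP_le N₀ t ht (j+1)
      have h6 : Real.exp ((j+1) * M) = (2 * (p+q))^(j+1) := by
        rw [hM, show ((j:ℝ)+1) = ((j+1:ℕ):ℝ) by push_cast; rfl, Real.exp_nat_mul,
          Real.exp_log (by linarith)]
      rw [Real.exp_add, h6, mul_pow]
      calc ((p:ℝ)+q)^(j+1) * CP N₀ t (j+1)
          ≤ ((p:ℝ)+q)^(j+1) * (2^(j+1) * Real.exp (t/2 * CL N₀ (j+1))) := by gcongr
        _ = _ := by ring
  have h7 := CL_succ_le N₀ j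
  have h8 := hC j
  rw [div_mul_eq_mul_div, div_le_iff₀ (by positivity)] at h8
  rw [div_le_iff₀ (by positivity)] at h1
  have h9 := mul_le_mul_of_nonneg_left h7 (by positivity : 0 ≤ t/2)
  have h10 := mul_le_mul_of_nonneg_left hL (by positivity : 0 ≤ t/2 + ε/2)
  nlinarith

/-! ### The lower bound -/

section lower
variable {N₀ : ℕ} {t : ℝ}

/-- partial sums -/
noncomputable def CS (N₀ : ℕ) (f : ℕ → ℕ) (k : ℕ) : ℝ := ∑ i ∈ Finset.Icc 1 k, Cδ N₀ i * f i

lemma CS_succ (f : ℕ → ℕ) (k : ℕ) : CS N₀ f (k+1) = CS N₀ f k + Cδ N₀ (k+1) * f (k+1) := by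
  unfold CS
  rw [Finset.sum_Icc_succ_top (by omega)]

/-- the point with digits `f` -/
noncomputable def Cpt (N₀ : ℕ) (f : ℕ → ℕ) : ℝ := ⨆ k, CS N₀ f k

lemma CS_mono (f : ℕ → ℕ) : Monotone (CS N₀ f) := by
  refine monotone_nat_of_le_succ fun k => ?_
  rw [CS_succ]
  have := Cd_pos N₀ (k+1)
  have : 0 ≤ Cδ N₀ (k+1) * f (k+1) := by positivity
  linarith

lemma CS_anti (f : ℕ → ℕ) (hf : ∀ k, f (k+1) < N₀ + (k+1)) :
    Antitone (fun k => CS N₀ f k + Cδ N₀ k) := by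
  refine antitone_nat_of_succ_le fun k => ?_
  rw [CS_succ, ← Cd_succ' N₀ k]
  have h := Cd_pos N₀ (k+1)
  have h2 : ((f (k+1) : ℝ) + 1) ≤ (N₀:ℝ) + (k+1) := by exact_mod_cast hf k
  nlinarith

lemma CS_le_add (f : ℕ → ℕ) (hf : ∀ k, f (k+1) < N₀ + (k+1)) (k m : ℕ) :
    CS N₀ f m ≤ CS N₀ f k + Cδ N₀ k := by
  have h1 := CS_mono (N₀ := N₀) f (le_max_left m k)
  have h2 := CS_anti (N₀ := N₀) f hf (le_max_right m k)
  have h3 := Cd_pos N₀ (max m k)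
  simp only at h2
  linarith

lemma Cpt_le (f : ℕ → ℕ) (hf : ∀ k, f (k+1) < N₀ + (k+1)) (k : ℕ) :
    Cpt N₀ f ≤ CS N₀ f k + Cδ N₀ k := ciSup_le fun m => CS_le_add f hf k m

lemma le_Cpt (f : ℕ → ℕ) (hf : ∀ k, f (k+1) < N₀ + (k+1)) (k : ℕ) :
    CS N₀ f k ≤ Cpt N₀ f := by
  refine le_ciSup (f := CS N₀ f) ⟨CS N₀ f 0 + Cδ N₀ 0, ?_⟩ k
  rintro _ ⟨m, rfl⟩
  exact CS_le_add f hf 0 m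

lemma CN_lt (hsmall : ∀ k : ℕ, 1 ≤ k → ((N₀ : ℝ) + k)⁻¹ * CN N₀ t k < 1) (k : ℕ) :
    CN N₀ t (k+1) < N₀ + (k+1) := by
  have h := hsmall (k+1) (by omega)
  rw [inv_mul_lt_iff₀ (by positivity), mul_one] at h
  exact_mod_cast h

lemma CN_pos (k : ℕ) : 0 < CN N₀ t (k+1) := by
  unfold CN
  apply Nat.ceil_pos.2
  positivity

lemma CP_pos (k : ℕ) : 0 < CP N₀ t k := by
  induction k with
  | zero => simp [CP_zero]
  | succ k ih => rw [CP_succ]; exact Nat.mul_pos ih (CN_pos k)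

lemma Cpt_mem (hsmall : ∀ k : ℕ, 1 ≤ k → ((N₀ : ℝ) + k)⁻¹ * CN N₀ t k < 1)
    (f : ℕ → ℕ) (hf : ∀ k, f (k+1) < CN N₀ t (k+1)) : Cpt N₀ f ∈ CF N₀ t := by
  have hf' : ∀ k, f (k+1) < N₀ + (k+1) := fun k => (hf k).trans (CN_lt hsmall k)
  refine Set.mem_iInter.2 fun k => ⟨f, ?_, Cpt N₀ f - CS N₀ f k, ⟨?_, ?_⟩, ?_⟩
  · intro i hi
    obtain ⟨j, rfl⟩ := Nat.exists_eq_add_of_le' (Finset.mem_Icc.1 hi).1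
    exact hf j
  · linarith [le_Cpt f hf' k]
  · linarith [Cpt_le f hf' k]
  · unfold CS; ring

lemma Cpt_sep (hsmall : ∀ k : ℕ, 1 ≤ k → ((N₀ : ℝ) + k)⁻¹ * CN N₀ t k < 1)
    (f g : ℕ → ℕ) (hf : ∀ k, f (k+1) < CN N₀ t (k+1)) (hg : ∀ k, g (k+1) < CN N₀ t (k+1))
    (k : ℕ) (hk : ∀ i < k, f (i+1) = g (i+1)) (hlt : f (k+1) < g (k+1)) :
    Cδ N₀ (k+2) ≤ Cpt N₀ g - Cpt N₀ f := by
  have hf' : ∀ k, f (k+1) < N₀ + (k+1) := fun k => (hf k).trans (CN_lt hsmall k)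
  have hg' : ∀ k, g (k+1) < N₀ + (k+1) := fun k => (hg k).trans (CN_lt hsmall k)
  have heq : CS N₀ f k = CS N₀ g k := by
    unfold CS
    refine Finset.sum_congr rfl fun i hi => ?_
    have hi := Finset.mem_Icc.1 hi
    obtain ⟨j, rfl⟩ := Nat.exists_eq_add_of_le' hi.1
    rw [hk j (by omega)]
  have h1 := Cpt_le f hf' (k+2)
  have h2 := le_Cpt g hg' (k+1)
  rw [CS_succ] at h1 h2
  rw [CS_succ] at h1
  have h3 := Cd_succ' N₀ (k+1)
  have h4 := Cd_pos N₀ (k+2)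
  have h5 := Cd_pos N₀ (k+1)
  have h6 : f (k+2) + 2 ≤ N₀ + (k+2) := by
    have a := hf (k+1)
    have b := CN_lt hsmall (k+1)
    simp only [add_assoc, Nat.reduceAdd] at a b
    omega
  have h6' : (f (k+2) : ℝ) + 2 ≤ N₀ + (k+2) := by exact_mod_cast h6
  have h7 : (f (k+1) : ℝ) + 1 ≤ g (k+1) := by exact_mod_cast hlt
  have h8 := mul_le_mul_of_nonneg_left h6' h4.le
  have h9 := mul_le_mul_of_nonneg_left h7 h5.le
  push_cast at h3
  simp only [add_assoc, Nat.reduceAdd] at h1 h2 h3 h8 h9 ⊢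
  norm_num at h3
  nlinarith

/-- mixed radix digits -/
noncomputable def Cdig (N₀ : ℕ) (t : ℝ) (y : ℝ) (i : ℕ) : ℕ := ⌊(CP N₀ t i : ℝ) * y⌋₊ % CN N₀ t i

lemma Cdig_lt (y : ℝ) (k : ℕ) : Cdig N₀ t y (k+1) < CN N₀ t (k+1) := Nat.mod_lt _ (CN_pos k)

lemma Cdig_floor {y z : ℝ} (hy : y ∈ Ico (0:ℝ) 1) (hz : z ∈ Ico (0:ℝ) 1) (k : ℕ)
    (h : ∀ i < k, Cdig N₀ t y (i+1) = Cdig N₀ t z (i+1)) :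
    ⌊(CP N₀ t k : ℝ) * y⌋₊ = ⌊(CP N₀ t k : ℝ) * z⌋₊ := by
  induction k with
  | zero =>
    simp only [CP_zero, Nat.cast_one, one_mul]
    rw [Nat.floor_eq_zero.2 hy.2, Nat.floor_eq_zero.2 hz.2]
  | succ k ih =>
    have ih := ih fun i hi => h i (by omega)
    have hd := h k (by omega)
    unfold Cdig at hd
    have key : ∀ y : ℝ, ⌊(CP N₀ t (k+1) : ℝ) * y⌋₊ / CN N₀ t (k+1) = ⌊(CP N₀ t k : ℝ) * y⌋₊ := by
      intro y
      rw [← Nat.floor_div_natCast, CP_succ]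
      congr 1
      have : (CN N₀ t (k+1) : ℝ) ≠ 0 := by exact_mod_cast (CN_pos k).ne'
      push_cast
      field_simp
    rw [← Nat.div_add_mod (⌊(CP N₀ t (k+1) : ℝ) * y⌋₊) (CN N₀ t (k+1)),
      ← Nat.div_add_mod (⌊(CP N₀ t (k+1) : ℝ) * z⌋₊) (CN N₀ t (k+1)), key, key, ih, hd]

lemma Cdig_close {y z : ℝ} (hy : y ∈ Ico (0:ℝ) 1) (hz : z ∈ Ico (0:ℝ) 1) (k : ℕ)
    (h : ∀ i < k, Cdig N₀ t y (i+1) = Cdig N₀ t z (i+1)) :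
    |y - z| ≤ Real.exp (- (t/2 * CL N₀ k)) := by
  have h1 := Cdig_floor hy hz k h
  have hP : (0:ℝ) < CP N₀ t k := by exact_mod_cast CP_pos k
  have a1 := Nat.floor_le (mul_nonneg hP.le hy.1)
  have a2 := Nat.lt_floor_add_one ((CP N₀ t k : ℝ) * y)
  have b1 := Nat.floor_le (mul_nonneg hP.le hz.1)
  have b2 := Nat.lt_floor_add_one ((CP N₀ t k : ℝ) * z)
  rw [h1] at a1 a2
  have h2 : |y - z| ≤ 1 / CP N₀ t k := by
    rw [le_div_iff₀ hP, ← abs_of_pos hP, ← abs_mul, abs_le]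
    constructor <;> nlinarith
  refine h2.trans ?_
  rw [Real.exp_neg, one_div]
  have := CP_ge N₀ t k
  gcongr

lemma CF_dim_ge (ht : 0 < t)
    (hsmall : ∀ k : ℕ, 1 ≤ k → ((N₀ : ℝ) + k)⁻¹ * CN N₀ t k < 1)
    (s : ℝ) (hs : 0 < s) (hst : s < t/2) : ENNReal.ofReal s ≤ dimH (CF N₀ t) := by
  obtain ⟨C, hC0, hC⟩ := CL_lin N₀ (2 * s / (t/2 - s)) (by
    have : 0 < t/2 - s := by linarith
    positivity)
  set K : ℝ := (t/2 - s) * C + s * (2 * N₀ + 1) with hK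
  set h : ℝ → ℝ := fun y => Cpt N₀ (Cdig N₀ t y) with hh
  have hδ : ∀ k, - (t/2 * CL N₀ k) ≤ K + s * (- CL N₀ (k+2)) := by
    intro k
    have h1 := hC k
    have h0 : 0 < t/2 - s := by linarith
    rw [div_mul_eq_mul_div, div_le_iff₀ h0] at h1
    have h2 := CL_succ_le N₀ k
    have h3 := CL_succ_le N₀ (k+1)
    have h4 : CL N₀ (k+2) ≤ CL N₀ k + (2 * N₀ + 2 * k + 1) := by
      push_cast at h3
      simp only [add_assoc, Nat.reduceAdd] at h2 h3 ⊢
      linarith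
    have := mul_le_mul_of_nonneg_left h4 hs.le
    rw [hK]
    nlinarith
  have hexp : ∀ y ∈ Ico (0:ℝ) 1, ∀ z ∈ Ico (0:ℝ) 1,
      |y - z| ≤ Real.exp K * |h y - h z| ^ s := by
    intro y hy z hz
    by_cases hall : ∀ i, Cdig N₀ t y (i+1) = Cdig N₀ t z (i+1)
    · have hyz : |y - z| ≤ 0 := by
        by_contra hcon
        push Not at hcon
        obtain ⟨C', _, hC'⟩ := CL_lin N₀ 1 zero_le_one
        obtain ⟨k, hk⟩ := exists_nat_gt (C' - Real.log |y - z| / (t/2))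
        have h1 := Cdig_close hy hz k (fun i _ => hall i)
        rw [← Real.log_le_iff_le_exp hcon] at h1
        have h2 := hC' k
        have h3 : - Real.log |y - z| / (t/2) < CL N₀ k := by
          rw [neg_div]; linarith
        rw [div_lt_iff₀ (by positivity)] at h3
        linarith
      refine hyz.trans ?_
      positivity
    · push Not at hall
      classical
      set k := Nat.find hall with hk
      have hne : Cdig N₀ t y (k+1) ≠ Cdig N₀ t z (k+1) := Nat.find_spec hall
      have heq : ∀ i < k, Cdig N₀ t y (i+1) = Cdig N₀ t z (i+1) := fun i hi =>
        not_not.1 (Nat.find_min hall hi)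
      have hsep : Cδ N₀ (k+2) ≤ |h y - h z| := by
        rcases lt_or_gt_of_ne hne with hlt | hlt
        · have := Cpt_sep hsmall _ _ (Cdig_lt y) (Cdig_lt z) k heq hlt
          rw [abs_sub_comm]
          exact this.trans (le_abs_self _)
        · have := Cpt_sep hsmall _ _ (Cdig_lt z) (Cdig_lt y) k (fun i hi => (heq i hi).symm) hlt
          exact this.trans (le_abs_self _)
      have hclose := Cdig_close hy hz k heq
      have hpos := Cd_pos N₀ (k+2)
      calc |y - z| ≤ Real.exp (- (t/2 * CL N₀ k)) := hclose
        _ ≤ Real.exp (K + s * (- CL N₀ (k+2))) := Real.exp_le_exp.2 (hδ k)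
        _ = Real.exp K * Cδ N₀ (k+2) ^ s := by
            rw [Real.exp_add, Cd_eq_exp, ← Real.exp_mul, mul_comm s]
        _ ≤ _ := by gcongr
  have hinj : InjOn h (Ico (0:ℝ) 1) := by
    intro y hy z hz hyz
    have := hexp y hy z hz
    rw [hyz, sub_self, abs_zero, Real.zero_rpow hs.ne', mul_zero] at this
    exact sub_eq_zero.1 (abs_eq_zero.1 (le_antisymm this (abs_nonneg _)))
  set g := Function.invFunOn h (Ico (0:ℝ) 1) with hg
  have hleft : LeftInvOn g h (Ico (0:ℝ) 1) := hinj.leftInvOn_invFunOn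
  have hH : HolderOnWith (Real.exp K).toNNReal s.toNNReal g (h '' Ico (0:ℝ) 1) := by
    rintro _ ⟨y, hy, rfl⟩ _ ⟨z, hz, rfl⟩
    rw [hleft hy, hleft hz, edist_dist, edist_dist, Real.dist_eq, Real.dist_eq,
      Real.coe_toNNReal _ hs.le, ENNReal.ofReal_rpow_of_nonneg (abs_nonneg _) hs.le]
    rw [show (((Real.exp K).toNNReal : NNReal) : ENNReal) = ENNReal.ofReal (Real.exp K) from rfl,
      ← ENNReal.ofReal_mul (Real.exp_pos K).le]
    exact ENNReal.ofReal_le_ofReal (hexp y hy z hz)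
  have hd := hH.dimH_image_le (Real.toNNReal_pos.2 hs)
  rw [hleft.image_image, Real.dimH_of_nonempty_interior (by simp)] at hd
  have hs' : (s.toNNReal : ENNReal) ≠ 0 := by simpa using hs
  have hd2 : ENNReal.ofReal s ≤ dimH (h '' Ico (0:ℝ) 1) := by
    have := (ENNReal.le_div_iff_mul_le (Or.inl hs') (Or.inl ENNReal.coe_ne_top)).1 hd
    rw [ENNReal.ofReal]; simpa using this
  refine hd2.trans (dimH_mono ?_)
  rintro _ ⟨y, _, rfl⟩
  exact Cpt_mem hsmall _ (Cdig_lt y)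

lemma CE_dim_ge (ht : 0 < t)
    (hsmall : ∀ k : ℕ, 1 ≤ k → ((N₀ : ℝ) + k)⁻¹ * CN N₀ t k < 1) (ξ : ℝ) :
    ENNReal.ofReal (t/2) ≤ dimH (CE N₀ t ξ) := by
  have hz : (0:ℝ) ∈ CF N₀ t := by
    have := Cpt_mem hsmall (fun _ => 0) (fun k => CN_pos k)
    simpa [Cpt, CS] using this
  have hsub : CF N₀ t ⊆ CE N₀ t ξ := fun x hx => ⟨x, hx, 0, hz, by ring⟩
  refine le_trans ?_ (dimH_mono hsub)
  have hT : Tendsto (fun s : ℝ => ENNReal.ofReal s) (nhdsWithin (t/2) (Iio (t/2)))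
      (nhds (ENNReal.ofReal (t/2))) :=
    ENNReal.tendsto_ofReal (tendsto_id.mono_left nhdsWithin_le_nhds)
  refine le_of_tendsto hT ?_
  have h0 : ∀ᶠ s in nhdsWithin (t/2) (Iio (t/2)), 0 < s :=
    nhdsWithin_le_nhds (Ioi_mem_nhds (by positivity))
  filter_upwards [h0, self_mem_nhdsWithin] with s h1 h2
  exact CF_dim_ge ht hsmall s h1 h2

end lower

/-- For every positive rational `ξ`, the sumset `F + ξF` of the Cantor set `F`
has Hausdorff and (upper and lower) box dimension `t/2`. -/
theorem stmt15 (t : ℝ) (ht : 0 < t) (ht2 : t < 2) (N₀ : ℕ)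
    (hsmall : ∀ k : ℕ, 1 ≤ k → ((N₀ : ℝ) + k)⁻¹ * CN N₀ t k < 1)
    (ξ : ℚ) (hξ : 0 < ξ) :
    dimH {z : ℝ | ∃ x ∈ CF N₀ t, ∃ y ∈ CF N₀ t, z = x + (ξ : ℝ) * y}
        = ENNReal.ofReal (t / 2) ∧
    lowerBoxDim {z : ℝ | ∃ x ∈ CF N₀ t, ∃ y ∈ CF N₀ t, z = x + (ξ : ℝ) * y} = t / 2 ∧
    upperBoxDim {z : ℝ | ∃ x ∈ CF N₀ t, ∃ y ∈ CF N₀ t, z = x + (ξ : ℝ) * y} = t / 2 := by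
  have hξ' : (0:ℝ) < (ξ:ℝ) := by exact_mod_cast hξ
  have hpq : (ξ:ℝ) * (ξ.den : ℕ) = (ξ.num.toNat : ℕ) := by
    have h1 : ((ξ.num.toNat : ℕ) : ℤ) = ξ.num := Int.toNat_of_nonneg (Rat.num_nonneg.2 hξ.le)
    have h2 : ((ξ.num.toNat : ℕ) : ℝ) = (ξ.num : ℝ) := by exact_mod_cast congrArg (Int.cast (R := ℝ)) h1
    rw [h2]
    exact_mod_cast Rat.mul_den_eq_num ξ
  refine box_of_bounds (E := CE N₀ t ξ) (by positivity) ?_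
    (fun ε hε => CE_up N₀ t ht ξ _ _ ξ.den_pos hpq hξ' ε hε) (CE_dim_ge ht hsmall ξ)
  intro δ hδ
  obtain ⟨k, hk⟩ := exists_level N₀ (1+ξ) δ (by linarith) hδ
  obtain ⟨U, hU1, hU2⟩ := CE_cover N₀ t ξ _ _ ξ.den_pos hpq hξ' k
  exact ⟨_, U, fun i => (hU1 i).trans (ENNReal.ofReal_le_ofReal hk), hU2⟩
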